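/- For integers m, n ≥ 1, let exp^{[m]} denote the m-fold iterate of the exponential function and ln^{[n]} the n-fold iterate of the natural logarithm. Suppose m ≤ n and M > 0 is large enough that ln^{[n]}(M) ≥ 0. Then for any c₁, c₂ ≥ 0, every solution w, z : [0,T) → [0,∞) of the system w'(t) = exp^{[m]}(z(t)), z'(t) = ln^{[n]}(M + w(t)) with w(0) = c₁, z(0) = c₂ on a finite interval [0,T) is bounded on [0,T); hence the solution exists globally on [0,∞). -/

import Mathlib

open Set MeasureTheory Filter

open Topology

lemma id_le_exp : (id : ℝ → ℝ) ≤ Real.exp := fun x => by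
  have := Real.add_one_le_exp x
  simp only [id]
  linarith

lemma exp_iterate_le_exp_iterate {m n : ℕ} (hmn : m ≤ n) {x y : ℝ} (hxy : x ≤ y) :
    Real.exp^[m] x ≤ Real.exp^[n] y :=
  (Real.exp_monotone.iterate m hxy).trans
    (Function.monotone_iterate_of_id_le id_le_exp hmn y)

lemma one_le_exp_iterate {m : ℕ} (hm : 1 ≤ m) {x : ℝ} (hx : 0 ≤ x) : 1 ≤ Real.exp^[m] x :=
  (Real.one_le_exp hx).trans (exp_iterate_le_exp_iterate (m := 1) hm le_rfl)

/-- On `[exp^[n] 0, ∞)` the iterated logarithm is a genuine inverse of the iterated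
exponential, and hence monotone there. -/
lemma log_iterate_le {n : ℕ} {x u : ℝ} (hx : Real.exp^[n] 0 ≤ x) (hu : x ≤ Real.exp^[n] u) :
    Real.log^[n] x ≤ u := by
  induction n generalizing x with
  | zero => simpa using hu
  | succ k ih =>
    rw [Function.iterate_succ_apply'] at hx hu
    rw [Function.iterate_succ_apply]
    have hpos : 0 < x := (Real.exp_pos _).trans_le hx
    exact ih ((Real.le_log_iff_exp_le hpos).2 hx) ((Real.log_le_iff_le_exp hpos).2 hu)

lemma exists_hasDerivAt_exp_iterate_comp {v : ℝ → ℝ} {v' t : ℝ} (hv : HasDerivAt v v' t)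
    (hv' : 1 ≤ v') (hv0 : 0 ≤ v t) (n : ℕ) :
    ∃ d, 1 ≤ d ∧ (1 ≤ n → Real.exp^[n] (v t) ≤ d) ∧
      HasDerivAt (fun s => Real.exp^[n] (v s)) d t := by
  induction n with
  | zero => exact ⟨v', hv', by simp, by simpa using hv⟩
  | succ k ih =>
    obtain ⟨d, hd, -, hder⟩ := ih
    have h1 : Real.exp^[k + 1] (v t) ≤ Real.exp (Real.exp^[k] (v t)) * d := by
      rw [Function.iterate_succ_apply']
      exact le_mul_of_one_le_right (Real.exp_pos _).le hd
    refine ⟨_, (one_le_exp_iterate (by omega) hv0).trans h1, fun _ => h1, ?_⟩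
    simpa only [Function.iterate_succ_apply'] using hder.exp

/-- Near any point `a`, the iterated logarithm either is differentiable with nonzero derivative,
or has an infinite limit there, of at most the order of an inverse square root. -/
lemma log_iterate_dichotomy (a : ℝ) (n : ℕ) :
    (∃ d ≠ 0, HasDerivAt (Real.log^[n]) d a) ∨
      (Tendsto (fun x => |Real.log^[n] x|) (𝓝[≠] a) atTop ∧
        ∃ C, 0 ≤ C ∧ ∀ᶠ x in 𝓝[≠] a, |Real.log^[n] x| ≤ C / √|x - a|) := by
  induction n with
  | zero => exact Or.inl ⟨1, one_ne_zero, hasDerivAt_id a⟩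
  | succ k ih =>
    have hsucc : Real.log^[k + 1] = fun x => Real.log (Real.log^[k] x) := by
      funext x; rw [Function.iterate_succ_apply']
    rw [hsucc]
    rcases ih with ⟨d, hd, hder⟩ | ⟨htop, C, hC, hb⟩
    · by_cases h0 : Real.log^[k] a = 0
      · right
        have hlim : Tendsto (fun x => Real.log^[k] x) (𝓝[≠] a) (𝓝[≠] 0) := by
          simpa [h0] using hder.tendsto_nhdsNE hd
        refine ⟨tendsto_abs_atBot_atTop.comp (Real.tendsto_log_nhdsNE_zero.comp hlim), ?_⟩
        have hslope := (hasDerivAt_iff_tendsto_slope.1 hder).abs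
        have hpos : 0 < |d| := abs_pos.2 hd
        have hlow := hslope.eventually (lt_mem_nhds (half_lt_self hpos))
        have hsmall : ∀ᶠ x in 𝓝[≠] a, |Real.log^[k] x| < 1 := by
          have : ∀ᶠ y in 𝓝[≠] (0 : ℝ), |y| < 1 :=
            nhdsWithin_le_nhds (continuous_abs.continuousAt.eventually_lt
              continuousAt_const (by simp))
          exact hlim.eventually this
        refine ⟨2 / √(|d| / 2), by positivity, ?_⟩
        filter_upwards [hlow, hsmall, self_mem_nhdsWithin] with x hx hx1 hxa
        have hxa' : 0 < |x - a| := abs_pos.2 (sub_ne_zero.2 hxa)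
        rw [slope_def_field, h0, sub_zero, abs_div, lt_div_iff₀ hxa'] at hx
        set y := |Real.log^[k] x| with hy
        have hy0 : 0 < y := lt_trans (by positivity) hx
        have hs : 0 < √y := Real.sqrt_pos.2 hy0
        rw [← Real.log_abs, abs_of_nonpos (Real.log_nonpos hy0.le hx1.le)]
        have h2 : -Real.log y ≤ 2 / √y := by
          have := Real.one_sub_inv_le_log_of_pos hs
          rw [Real.log_sqrt hy0.le] at this
          rw [div_eq_mul_inv]
          linarith
        refine h2.trans ?_
        rw [div_div, ← Real.sqrt_mul (by positivity)]
        gcongr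
      · exact Or.inl ⟨_, div_ne_zero hd h0, hder.log h0⟩
    · right
      have hlog : Tendsto (fun x => Real.log (Real.log^[k] x)) (𝓝[≠] a) atTop := by
        simpa only [Function.comp_def, Real.log_abs] using Real.tendsto_log_atTop.comp htop
      refine ⟨tendsto_abs_atTop_atTop.comp hlog, C, hC, ?_⟩
      filter_upwards [hb, hlog.eventually_ge_atTop 0] with x hx h0
      rw [abs_of_nonneg h0, ← Real.log_abs]
      exact (Real.log_le_self (abs_nonneg _)).trans hx

lemma log_iterate_le_div_sqrt (a : ℝ) (n : ℕ) :
    ∃ C, 0 ≤ C ∧ ∀ᶠ x in 𝓝[≠] a, Real.log^[n] x ≤ C / √|x - a| := by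
  rcases log_iterate_dichotomy a n with ⟨d, -, hder⟩ | ⟨-, C, hC, hb⟩
  · refine ⟨|Real.log^[n] a| + 1, by positivity, ?_⟩
    have h1 : ∀ᶠ x in 𝓝 a, Real.log^[n] x < |Real.log^[n] a| + 1 :=
      hder.continuousAt.eventually_lt continuousAt_const
        (lt_of_le_of_lt (le_abs_self _) (lt_add_one _))
    have h2 : ∀ᶠ x in 𝓝 a, |x - a| < 1 := by
      have : ContinuousAt (fun x => |x - a|) a := by fun_prop
      exact this.eventually_lt continuousAt_const (by simp)
    filter_upwards [nhdsWithin_le_nhds h1, nhdsWithin_le_nhds h2, self_mem_nhdsWithin]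
      with x hx1 hx2 hxa
    have hxa' : 0 < |x - a| := abs_pos.2 (sub_ne_zero.2 hxa)
    refine hx1.le.trans (le_div_self (by positivity) (Real.sqrt_pos.2 hxa') ?_)
    exact Real.sqrt_le_one.2 hx2.le
  · exact ⟨C, hC, hb.mono fun x hx => (le_abs_self _).trans hx⟩

/-- A function whose derivative is at most `f (x t)`, where `x' ≥ 1` and `x` is bounded, is itself
bounded above, as soon as `f` has only inverse square root singularities. -/
lemma bddAbove_of_deriv_le_comp {f x z x' z' : ℝ → ℝ} {T B : ℝ}
    (hf : ∀ a, ∃ C, 0 ≤ C ∧ ∀ᶠ y in 𝓝[≠] a, f y ≤ C / √|y - a|)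
    (hx : ∀ t ∈ Ico (0 : ℝ) T, HasDerivAt x (x' t) t) (hx' : ∀ t ∈ Ico (0 : ℝ) T, 1 ≤ x' t)
    (hz : ∀ t ∈ Ico (0 : ℝ) T, HasDerivAt z (z' t) t)
    (hz' : ∀ t ∈ Ico (0 : ℝ) T, z' t ≤ f (x t)) (hB : ∀ t ∈ Ico (0 : ℝ) T, x t ≤ B) :
    ∃ C, ∀ t ∈ Ico (0 : ℝ) T, z t ≤ C := by
  rcases le_or_gt T 0 with hT | hT
  · exact ⟨0, fun t ht => absurd (ht.1.trans_lt ht.2) hT.not_gt⟩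
  have hmono : StrictMonoOn x (Ico 0 T) := by
    refine strictMonoOn_of_deriv_pos (convex_Ico 0 T)
      (fun t ht => (hx t ht).continuousAt.continuousWithinAt) fun t ht => ?_
    have ht' := interior_subset ht
    rw [(hx t ht').deriv]
    exact zero_lt_one.trans_le (hx' t ht')
  have hne : (x '' Ico 0 T).Nonempty := ⟨x 0, 0, ⟨le_rfl, hT⟩, rfl⟩
  have hbdd : BddAbove (x '' Ico 0 T) := ⟨B, by rintro _ ⟨t, ht, rfl⟩; exact hB t ht⟩
  set a := sSup (x '' Ico 0 T) with ha
  have hlt : ∀ t ∈ Ico (0 : ℝ) T, x t < a := fun t ht => by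
    have hs : (t + T) / 2 ∈ Ico (0 : ℝ) T := ⟨by linarith [ht.1, ht.2], by linarith [ht.2]⟩
    exact (hmono ht hs (by linarith [ht.2])).trans_le (le_csSup hbdd ⟨_, hs, rfl⟩)
  obtain ⟨C, hC, hev⟩ := hf a
  obtain ⟨ε, hε, hball⟩ := Metric.mem_nhdsWithin_iff.1 hev
  obtain ⟨_, ⟨t₁, ht₁, rfl⟩, hat₁⟩ := exists_lt_of_lt_csSup hne (sub_lt_self a hε)
  have hsub : ∀ t ∈ Ico t₁ T, t ∈ Ico (0 : ℝ) T := fun t ht => ⟨ht₁.1.trans ht.1, ht.2⟩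
  have hkey : ∀ t ∈ Ico t₁ T, f (x t) ≤ C / √(a - x t) := fun t ht => by
    have h1 := hlt t (hsub t ht)
    have h2 : x t₁ ≤ x t := hmono.monotoneOn ht₁ (hsub t ht) ht.1
    have h3 : |x t - a| = a - x t := by rw [abs_sub_comm, abs_of_pos (sub_pos.2 h1)]
    have := hball (show x t ∈ Metric.ball a ε ∩ {a}ᶜ from
      ⟨by rw [Metric.mem_ball, Real.dist_eq, h3]; linarith, h1.ne⟩)
    simpa only [mem_ofPred_eq, h3] using this
  have hder : ∀ t ∈ Ico t₁ T, HasDerivAt (fun s => z s + 2 * C * √(a - x s))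
      (z' t + 2 * C * (-x' t / (2 * √(a - x t)))) t := fun t ht => by
    have hpos := sub_pos.2 (hlt t (hsub t ht))
    exact (hz t (hsub t ht)).add
      ((((hx t (hsub t ht)).const_sub a).sqrt hpos.ne').const_mul (2 * C))
  have hanti : AntitoneOn (fun s => z s + 2 * C * √(a - x s)) (Ico t₁ T) := by
    refine antitoneOn_of_deriv_nonpos (convex_Ico t₁ T)
      (fun t ht => (hder t ht).continuousAt.continuousWithinAt)
      (fun t ht => (hder t (interior_subset ht)).differentiableAt.differentiableWithinAt)
      fun t ht => ?_
    have ht' := interior_subset ht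
    rw [(hder t ht').deriv]
    have hpos := Real.sqrt_pos.2 (sub_pos.2 (hlt t (hsub t ht')))
    have h1 : C / √(a - x t) ≤ C / √(a - x t) * x' t :=
      le_mul_of_one_le_right (by positivity) (hx' t (hsub t ht'))
    have h2 : 2 * C * (-x' t / (2 * √(a - x t))) = -(C / √(a - x t) * x' t) := by
      field_simp
    linarith [hkey t ht', hz' t (hsub t ht')]
  obtain ⟨D, hD⟩ := (isCompact_Icc (a := (0 : ℝ)) (b := t₁)).bddAbove_image (f := z)
    fun t ht => (hz t ⟨ht.1, ht.2.trans_lt ht₁.2⟩).continuousAt.continuousWithinAt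
  refine ⟨max D (z t₁ + 2 * C * √(a - x t₁)), fun t ht => ?_⟩
  rcases le_total t t₁ with h | h
  · exact le_max_of_le_left (hD ⟨t, ⟨ht.1, h⟩, rfl⟩)
  · refine le_max_of_le_right (le_trans ?_ (hanti ⟨le_rfl, ht₁.2⟩ ⟨h, ht.2⟩ h))
    exact le_add_of_nonneg_right (by positivity)

/-- Comparison principle for a pair of functions: if the differences `f`, `g` start positive and
each has nonnegative derivative as long as both are positive, then both stay positive. -/
lemma pos_of_deriv_nonneg_of_pos {f g f' g' : ℝ → ℝ} {a b : ℝ}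
    (hf : ∀ t ∈ Icc a b, HasDerivAt f (f' t) t) (hg : ∀ t ∈ Icc a b, HasDerivAt g (g' t) t)
    (hfa : 0 < f a) (hga : 0 < g a)
    (hf' : ∀ t ∈ Icc a b, 0 < f t → 0 < g t → 0 ≤ f' t)
    (hg' : ∀ t ∈ Icc a b, 0 < f t → 0 < g t → 0 ≤ g' t) :
    ∀ t ∈ Icc a b, 0 < f t ∧ 0 < g t := by
  by_contra! hcon
  obtain ⟨s, hs, hs'⟩ := hcon
  have hfc : ContinuousOn f (Icc a b) := fun t ht => (hf t ht).continuousAt.continuousWithinAt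
  have hgc : ContinuousOn g (Icc a b) := fun t ht => (hg t ht).continuousAt.continuousWithinAt
  have hcomp : IsCompact (Icc a b ∩ (fun t => min (f t) (g t)) ⁻¹' Iic 0) :=
    isCompact_Icc.of_isClosed_subset
      ((hfc.inf hgc).preimage_isClosed_of_isClosed isClosed_Icc isClosed_Iic) inter_subset_left
  have hne : (Icc a b ∩ (fun t => min (f t) (g t)) ⁻¹' Iic 0).Nonempty := by
    refine ⟨s, hs, ?_⟩
    rcases le_or_gt (f s) 0 with h | h
    · exact min_le_of_left_le h
    · exact min_le_of_right_le (hs' h)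
  obtain ⟨t₀, ⟨ht₀, hmin⟩, hleast⟩ := hcomp.exists_isLeast hne
  have hbefore : ∀ t ∈ Ico a t₀, 0 < f t ∧ 0 < g t := fun t ht => by
    by_contra h
    refine ht.2.not_ge (hleast ⟨⟨ht.1, ht.2.le.trans ht₀.2⟩, ?_⟩)
    rw [← lt_min_iff, not_lt] at h
    exact h
  have hsub : Icc a t₀ ⊆ Icc a b := Icc_subset_Icc_right ht₀.2
  have hfm : MonotoneOn f (Icc a t₀) := by
    refine monotoneOn_of_deriv_nonneg (convex_Icc a t₀) (hfc.mono hsub)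
      (fun t ht => (hf t (hsub (interior_subset ht))).differentiableAt.differentiableWithinAt)
      fun t ht => ?_
    have ht' := hsub (interior_subset ht)
    rw [interior_Icc] at ht
    have := hbefore t ⟨ht.1.le, ht.2⟩
    rw [(hf t ht').deriv]
    exact hf' t ht' this.1 this.2
  have hgm : MonotoneOn g (Icc a t₀) := by
    refine monotoneOn_of_deriv_nonneg (convex_Icc a t₀) (hgc.mono hsub)
      (fun t ht => (hg t (hsub (interior_subset ht))).differentiableAt.differentiableWithinAt)
      fun t ht => ?_
    have ht' := hsub (interior_subset ht)
    rw [interior_Icc] at ht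
    have := hbefore t ⟨ht.1.le, ht.2⟩
    rw [(hg t ht').deriv]
    exact hg' t ht' this.1 this.2
  have ha : a ∈ Icc a t₀ := ⟨le_rfl, ht₀.1⟩
  have hb : t₀ ∈ Icc a t₀ := ⟨ht₀.1, le_rfl⟩
  exact (lt_min (hfa.trans_le (hfm ha hb ht₀.1)) (hga.trans_le (hgm ha hb ht₀.1))).not_ge hmin

/-- Example 2.3(iv) of the paper: for the system `w' = exp^[m](z)`,
`z' = ln^[n](M + w)` with `m ≤ n` and `M` large enough that `ln^[n](M) ≥ 0`, every
solution with nonnegative initial data on a finite interval `[0,T)` is bounded; hence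
the solution exists globally. -/
theorem global_existence_iterated_exp_log
    (m n : ℕ) (hm : 1 ≤ m) (hn : 1 ≤ n) (hmn : m ≤ n)
    (M : ℝ) (hM : 0 < M) (hlog : 0 ≤ Real.log^[n] M)
    (c₁ c₂ T : ℝ) (hc₁ : 0 ≤ c₁) (hc₂ : 0 ≤ c₂)
    (w z : ℝ → ℝ)
    (hw0 : w 0 = c₁) (hz0 : z 0 = c₂)
    (hnn : ∀ t ∈ Ico (0 : ℝ) T, 0 ≤ w t ∧ 0 ≤ z t)
    (hw' : ∀ t ∈ Ico (0 : ℝ) T, HasDerivAt w (Real.exp^[m] (z t)) t)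
    (hz' : ∀ t ∈ Ico (0 : ℝ) T, HasDerivAt z (Real.log^[n] (M + w t)) t) :
    ∃ C : ℝ, ∀ t ∈ Ico (0 : ℝ) T, w t ≤ C ∧ z t ≤ C := by
  have hx : ∀ t ∈ Ico (0 : ℝ) T, HasDerivAt (fun s => M + w s) (Real.exp^[m] (z t)) t :=
    fun t ht => (hw' t ht).const_add M
  have hx1 : ∀ t ∈ Ico (0 : ℝ) T, 1 ≤ Real.exp^[m] (z t) :=
    fun t ht => one_le_exp_iterate hm (hnn t ht).2
  by_cases hbig : ∃ t₁ ∈ Ico (0 : ℝ) T, Real.exp^[n] 0 ≤ M + w t₁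
  swap
  · push Not at hbig
    obtain ⟨C, hC⟩ := bddAbove_of_deriv_le_comp (f := Real.log^[n])
      (fun a => log_iterate_le_div_sqrt a n) hx hx1 hz' (fun t _ => le_rfl)
      (fun t ht => (hbig t ht).le)
    exact ⟨max (Real.exp^[n] 0) C, fun t ht => ⟨le_max_of_le_left (by linarith [hbig t ht]),
      le_max_of_le_right (hC t ht)⟩⟩
  obtain ⟨t₁, ht₁, hlarge⟩ := hbig
  have hmono : MonotoneOn (fun s => M + w s) (Ico 0 T) := by
    refine monotoneOn_of_deriv_nonneg (convex_Ico 0 T)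
      (fun t ht => (hx t ht).continuousAt.continuousWithinAt)
      (fun t ht => (hx t (interior_subset ht)).differentiableAt.differentiableWithinAt)
      fun t ht => ?_
    rw [(hx t (interior_subset ht)).deriv]
    exact zero_le_one.trans (hx1 t (interior_subset ht))
  obtain ⟨K, hK⟩ : ∃ K, K = M + w t₁ + z t₁ + 1 := ⟨_, rfl⟩
  have h₁ := hnn t₁ ht₁
  have hK1 : 1 ≤ K := by linarith
  set u : ℝ → ℝ := fun t => K * Real.exp (t - t₁) with hu
  have hud : ∀ t, HasDerivAt u (u t) t := fun t => by
    simpa [hu] using (((hasDerivAt_id t).sub_const t₁).exp).const_mul K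
  have hu1 : ∀ t, t₁ ≤ t → 1 ≤ u t := fun t ht =>
    one_le_mul_of_one_le_of_one_le hK1 (Real.one_le_exp (sub_nonneg.2 ht))
  have hmonoU : ∀ t, t ≤ T → u t ≤ u T := fun t ht => by
    simp only [hu]; gcongr
  have hut₁ : u t₁ = K := by simp [hu]
  have hle_iter : ∀ y : ℝ, y ≤ Real.exp^[n] y := fun y =>
    exp_iterate_le_exp_iterate (m := 0) (Nat.zero_le n) le_rfl
  have hchoice : ∀ t, ∃ d, t₁ ≤ t → Real.exp^[n] (u t) ≤ d ∧
      HasDerivAt (fun s => Real.exp^[n] (u s)) d t := fun t => by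
    by_cases ht : t₁ ≤ t
    · obtain ⟨d, -, h1, h2⟩ := exists_hasDerivAt_exp_iterate_comp (hud t) (hu1 t ht)
        (zero_le_one.trans (hu1 t ht)) n
      exact ⟨d, fun _ => ⟨h1 hn, h2⟩⟩
    · exact ⟨0, fun h => absurd h ht⟩
  choose d hd using hchoice
  have hcmp : ∀ t ∈ Ico t₁ T, M + w t ≤ Real.exp^[n] (u t) ∧ z t ≤ u t := fun t ht => by
    have hsub : ∀ s ∈ Icc t₁ t, s ∈ Ico (0 : ℝ) T :=
      fun s hs => ⟨ht₁.1.trans hs.1, hs.2.trans_lt ht.2⟩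
    have := pos_of_deriv_nonneg_of_pos (a := t₁) (b := t)
      (f := fun s => Real.exp^[n] (u s) - (M + w s)) (g := fun s => u s - z s)
      (fun s hs => (hd s hs.1).2.sub (hx s (hsub s hs)))
      (fun s hs => (hud s).sub (hz' s (hsub s hs)))
      (by
        have := hle_iter (u t₁)
        rw [hut₁] at this
        simp only [hut₁]
        linarith)
      (by simp only [hut₁]; linarith)
      (fun s hs _ h2 => sub_nonneg.2 <|
        (exp_iterate_le_exp_iterate hmn (sub_pos.1 h2).le).trans (hd s hs.1).1)
      (fun s hs h1 _ => sub_nonneg.2 <|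
        log_iterate_le (hlarge.trans (hmono ht₁ (hsub s hs) hs.1)) (sub_pos.1 h1).le)
      t ⟨ht.1, le_rfl⟩
    exact ⟨(sub_pos.1 this.1).le, (sub_pos.1 this.2).le⟩
  obtain ⟨D, hD⟩ := (isCompact_Icc (a := (0 : ℝ)) (b := t₁)).bddAbove_image (f := z)
    fun t ht => (hz' t ⟨ht.1, ht.2.trans_lt ht₁.2⟩).continuousAt.continuousWithinAt
  refine ⟨max D (Real.exp^[n] (u T)), fun t ht => ⟨le_max_of_le_right ?_, ?_⟩⟩
  · rcases le_total t t₁ with h | h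
    · have h2 : M + w t ≤ M + w t₁ := hmono ht ht₁ h
      have h3 := (hcmp t₁ ⟨le_rfl, ht₁.2⟩).1
      have h4 : Real.exp^[n] (u t₁) ≤ Real.exp^[n] (u T) :=
        exp_iterate_le_exp_iterate le_rfl (hmonoU t₁ ht₁.2.le)
      linarith
    · have h3 := (hcmp t ⟨h, ht.2⟩).1
      have h4 : Real.exp^[n] (u t) ≤ Real.exp^[n] (u T) :=
        exp_iterate_le_exp_iterate le_rfl (hmonoU t ht.2.le)
      linarith
  · rcases le_total t t₁ with h | h
    · exact le_max_of_le_left (hD ⟨t, ⟨ht.1, h⟩, rfl⟩)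
    · exact le_max_of_le_right <|
        (hcmp t ⟨h, ht.2⟩).2.trans ((hmonoU t ht.2.le).trans (hle_iter _))
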